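/- Let θ ∈ (0, π/2). Let u± = e₀⊗e₀ ± e₁⊗e₁, w = e₀⊗e₀ + i e₁⊗e₁ and w̄ = e₀⊗e₀ − i e₁⊗e₁ in ℂ²⊗ℂ² ≅ ℂ⁴. Define τ : Fin 4 → Matrix (Fin 4) (Fin 4) ℂ by τ₀ = (cos²θ/4) u₊u₊†, τ₁ = (sin²θ/4) u₊u₊†, τ₂ = (sin²θ/4) u₋u₋†, τ₃ = (cos²θ/4) u₋u₋†, and σ : Fin 4 → Matrix (Fin 4) (Fin 4) ℂ by σ₀ = σ₃ = (1/8) w w† and σ₁ = σ₂ = (1/8) w̄ w̄† (these are Bob's conditional states for the 4-qubit mixed entangled state ρ(θ) = cos²θ|LC₄⟩⟨LC₄| + sin²θ|LC₄′⟩⟨LC₄′| under Alice's ẑẑ and ŷx̂ measurements). Then there exists no local-hidden-state model for (τ, σ). This is the EPR steering paradox '2 = 1' for the 4-qubit mixed entangled state. -/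

import Mathlib

open Matrix BigOperators ComplexOrder

noncomputable section

/-- The outer product `v v†`. -/
def outerProd {d : Type*} [Fintype d] (v : d → ℂ) : Matrix d d ℂ :=
  fun j k => v j * (starRingEnd ℂ) (v k)

/-- Tensor product of vectors: `(x ⊗ y) (a, b) = x a * y b`. -/
def tvec {A B : Type*} (x : A → ℂ) (y : B → ℂ) : A × B → ℂ :=
  fun p => x p.1 * y p.2

/-- Standard basis vector `e_a` of `ℂ²`. -/
def e2 (a : Fin 2) : Fin 2 → ℂ := fun i => if i = a then 1 else 0

/-- `u± = e₀⊗e₀ ± e₁⊗e₁`. -/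
def uP : Fin 2 × Fin 2 → ℂ := tvec (e2 0) (e2 0) + tvec (e2 1) (e2 1)
def uM : Fin 2 × Fin 2 → ℂ := tvec (e2 0) (e2 0) - tvec (e2 1) (e2 1)

/-- `w = e₀⊗e₀ + i e₁⊗e₁` and `w̄ = e₀⊗e₀ − i e₁⊗e₁`. -/
def wv : Fin 2 × Fin 2 → ℂ := tvec (e2 0) (e2 0) + Complex.I • tvec (e2 1) (e2 1)
def wb : Fin 2 × Fin 2 → ℂ := tvec (e2 0) (e2 0) - Complex.I • tvec (e2 1) (e2 1)

/-- A local-hidden-state (LHS) model for two families of (unnormalized) conditional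
states. -/
def IsLHSModel {B : Type*} [Fintype B] [DecidableEq B] {K₁ K₂ : ℕ}
    (τ : Fin K₁ → Matrix B B ℂ) (σ : Fin K₂ → Matrix B B ℂ) : Prop :=
  ∃ (L : ℕ) (ρ : Fin L → Matrix B B ℂ) (w : Fin L → ℝ)
    (p₁ : Fin K₁ → Fin L → ℝ) (p₂ : Fin K₂ → Fin L → ℝ),
    (∀ ξ, (ρ ξ).PosSemidef) ∧ (∀ ξ, (ρ ξ).trace = 1) ∧
    (∀ ξ, w ξ ∈ Set.Icc (0 : ℝ) 1) ∧ (∑ ξ, w ξ = 1) ∧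
    (∀ a ξ, p₁ a ξ ∈ Set.Icc (0 : ℝ) 1) ∧
    (∀ b ξ, p₂ b ξ ∈ Set.Icc (0 : ℝ) 1) ∧
    (∀ ξ, ∑ a, p₁ a ξ = 1) ∧ (∀ ξ, ∑ b, p₂ b ξ = 1) ∧
    (∀ a, τ a = ∑ ξ, (p₁ a ξ * w ξ) • ρ ξ) ∧
    (∀ b, σ b = ∑ ξ, (p₂ b ξ * w ξ) • ρ ξ)

/-- The quadratic form of `v v†` vanishes at every vector orthogonal to `v`. -/
theorem outerProd_form_eq_zero {d : Type*} [Fintype d] {v x : d → ℂ} (c : ℝ)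
    (h : star v ⬝ᵥ x = 0) : star x ⬝ᵥ ((c • outerProd v) *ᵥ x) = 0 := by
  have hv : outerProd v = vecMulVec v (star v) := rfl
  rw [hv, smul_mulVec, vecMulVec_mulVec, h]
  simp

/-- If the quadratic form of a nonnegative combination of positive semidefinite matrices vanishes
at `x`, then every matrix that occurs in it with a nonzero weight annihilates `x`. -/
theorem mulVec_eq_zero_of_sum_form_eq_zero {ι d : Type*} [Fintype ι] [Fintype d]
    {ρ : ι → Matrix d d ℂ} {q : ι → ℝ} (hρ : ∀ ξ, (ρ ξ).PosSemidef) (hq : ∀ ξ, 0 ≤ q ξ)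
    {x : d → ℂ} (h : star x ⬝ᵥ ((∑ ξ, q ξ • ρ ξ) *ᵥ x) = 0) {ξ : ι} (hξ : q ξ ≠ 0) :
    ρ ξ *ᵥ x = 0 := by
  rw [sum_mulVec, dotProduct_sum] at h
  simp only [smul_mulVec, dotProduct_smul] at h
  have h0 := (Finset.sum_eq_zero_iff_of_nonneg fun η _ =>
    smul_nonneg (hq η) ((hρ η).dotProduct_mulVec_nonneg x)).1 h ξ (Finset.mem_univ ξ)
  exact ((hρ ξ).dotProduct_mulVec_zero_iff x).1 ((smul_eq_zero.1 h0).resolve_left hξ)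

/-- The vector `e₀⊗e₀ + s e₁⊗e₁`. -/
def diagVec (s : ℂ) : Fin 2 × Fin 2 → ℂ := tvec (e2 0) (e2 0) + s • tvec (e2 1) (e2 1)

theorem uP_eq_diagVec : uP = diagVec 1 := by simp [uP, diagVec]

theorem uM_eq_diagVec : uM = diagVec (-1) := by simp [uM, diagVec, sub_eq_add_neg]

theorem wv_eq_diagVec : wv = diagVec Complex.I := rfl

theorem wb_eq_diagVec : wb = diagVec (-Complex.I) := by simp [wb, diagVec, sub_eq_add_neg]

theorem star_diagVec_dotProduct (s t : ℂ) : star (diagVec s) ⬝ᵥ diagVec t = 1 + star s * t := by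
  simp [dotProduct, diagVec, tvec, e2, Fintype.sum_prod_type]

theorem star_diagVec_dotProduct_tvec {i j : Fin 2} (s : ℂ) (h : i ≠ j) :
    star (diagVec s) ⬝ᵥ tvec (e2 i) (e2 j) = 0 := by
  fin_cases i <;> fin_cases j <;>
    simp_all [dotProduct, diagVec, tvec, e2]

theorem mulVec_tvec_e2 (M : Matrix (Fin 2 × Fin 2) (Fin 2 × Fin 2) ℂ) (i j : Fin 2)
    (p : Fin 2 × Fin 2) : (M *ᵥ tvec (e2 i) (e2 j)) p = M p (i, j) := by
  fin_cases i <;> fin_cases j <;>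
    simp [mulVec, dotProduct, tvec, e2, Fintype.sum_prod_type]

/-- A matrix annihilating `e₀⊗e₁`, `e₁⊗e₀` and two distinct vectors `e₀⊗e₀ + s e₁⊗e₁` has
trace zero. -/
theorem trace_eq_zero_of_mulVec_diagVec {M : Matrix (Fin 2 × Fin 2) (Fin 2 × Fin 2) ℂ}
    (hM : ∀ i j : Fin 2, i ≠ j → M *ᵥ tvec (e2 i) (e2 j) = 0) {s t : ℂ} (hst : s ≠ t)
    (hs : M *ᵥ diagVec s = 0) (ht : M *ᵥ diagVec t = 0) : M.trace = 0 := by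
  have key (r : ℂ) (hr : M *ᵥ diagVec r = 0) (p : Fin 2 × Fin 2) :
      M p (0, 0) + r * M p (1, 1) = 0 := by
    simpa [diagVec, mulVec_add, mulVec_smul, mulVec_tvec_e2] using congrFun hr p
  have h11 (p : Fin 2 × Fin 2) : M p (1, 1) = 0 :=
    (mul_eq_zero.1 (by linear_combination key s hs p - key t ht p :
      (s - t) * M p (1, 1) = 0)).resolve_left (sub_ne_zero.2 hst)
  have h00 : M (0, 0) (0, 0) = 0 := by simpa [h11] using key s hs (0, 0)
  have h01 : M (0, 1) (0, 1) = 0 := by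
    simpa only [mulVec_tvec_e2, Pi.zero_apply] using congrFun (hM 0 1 (by decide)) (0, 1)
  have h10 : M (1, 0) (1, 0) = 0 := by
    simpa only [mulVec_tvec_e2, Pi.zero_apply] using congrFun (hM 1 0 (by decide)) (1, 0)
  simp [trace, Fintype.sum_prod_type, h00, h01, h10, h11]

/-- EPR steering paradox "2 = 1" for the 4-qubit mixed entangled state
`ρ(θ) = cos²θ |LC₄⟩⟨LC₄| + sin²θ |LC₄′⟩⟨LC₄′|`, `θ ∈ (0, π/2)`: Bob's conditional
states under Alice's ẑẑ and ŷx̂ measurements admit no local-hidden-state model. -/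
theorem steering_paradox_four_qubit_mixed {θ : ℝ} (hθ : θ ∈ Set.Ioo 0 (Real.pi / 2)) :
    ¬ IsLHSModel
        ![(Real.cos θ ^ 2 / 4) • outerProd uP, (Real.sin θ ^ 2 / 4) • outerProd uP,
          (Real.sin θ ^ 2 / 4) • outerProd uM, (Real.cos θ ^ 2 / 4) • outerProd uM]
        ![(1 / 8 : ℝ) • outerProd wv, (1 / 8 : ℝ) • outerProd wb,
          (1 / 8 : ℝ) • outerProd wb, (1 / 8 : ℝ) • outerProd wv] := by
  rintro ⟨L, ρ, w, p₁, p₂, hρ, htr, hw, hw1, hp₁, hp₂, hs₁, hs₂, hτ, hσ⟩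
  obtain ⟨ξ, -, hξ⟩ := Finset.exists_ne_zero_of_sum_ne_zero (hw1.trans_ne one_ne_zero)
  obtain ⟨a, -, ha⟩ := Finset.exists_ne_zero_of_sum_ne_zero ((hs₁ ξ).trans_ne one_ne_zero)
  obtain ⟨b, -, hb⟩ := Finset.exists_ne_zero_of_sum_ne_zero ((hs₂ ξ).trans_ne one_ne_zero)
  have kill₁ (c : ℝ) (s : ℂ)
      (h : c • outerProd (diagVec s) = ∑ ξ, (p₁ a ξ * w ξ) • ρ ξ) (x : Fin 2 × Fin 2 → ℂ)
      (hx : star (diagVec s) ⬝ᵥ x = 0) : ρ ξ *ᵥ x = 0 :=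
    mulVec_eq_zero_of_sum_form_eq_zero hρ (fun η => mul_nonneg (hp₁ a η).1 (hw η).1)
      (h ▸ outerProd_form_eq_zero c hx) (mul_ne_zero ha hξ)
  have kill₂ (c : ℝ) (s : ℂ)
      (h : c • outerProd (diagVec s) = ∑ ξ, (p₂ b ξ * w ξ) • ρ ξ) (x : Fin 2 × Fin 2 → ℂ)
      (hx : star (diagVec s) ⬝ᵥ x = 0) : ρ ξ *ᵥ x = 0 :=
    mulVec_eq_zero_of_sum_form_eq_zero hρ (fun η => mul_nonneg (hp₂ b η).1 (hw η).1)
      (h ▸ outerProd_form_eq_zero c hx) (mul_ne_zero hb hξ)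
  have hca : ∃ (c : ℝ) (s : ℂ), s ^ 2 = 1 ∧ star s = s ∧
      c • outerProd (diagVec s) = ∑ ξ, (p₁ a ξ * w ξ) • ρ ξ := by
    rw [← hτ a, uP_eq_diagVec, uM_eq_diagVec]
    fin_cases a
    exacts [⟨_, 1, by simp, by simp, rfl⟩, ⟨_, 1, by simp, by simp, rfl⟩,
      ⟨_, -1, by simp, by simp, rfl⟩, ⟨_, -1, by simp, by simp, rfl⟩]
  have hcb : ∃ (c : ℝ) (t : ℂ), t ^ 2 = -1 ∧ star t = -t ∧
      c • outerProd (diagVec t) = ∑ ξ, (p₂ b ξ * w ξ) • ρ ξ := by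
    rw [← hσ b, wv_eq_diagVec, wb_eq_diagVec]
    fin_cases b
    exacts [⟨_, Complex.I, by simp, by simp, rfl⟩, ⟨_, -Complex.I, by simp, by simp, rfl⟩,
      ⟨_, -Complex.I, by simp, by simp, rfl⟩, ⟨_, Complex.I, by simp, by simp, rfl⟩]
  obtain ⟨c, s, hs, hs', hc⟩ := hca
  obtain ⟨c', t, ht, ht', hc'⟩ := hcb
  have hst : -s ≠ -t := fun h => by
    rw [neg_inj.1 h, ht] at hs
    norm_num at hs
  refine zero_ne_one ((trace_eq_zero_of_mulVec_diagVec
    (fun i j hij => kill₁ c s hc _ (star_diagVec_dotProduct_tvec s hij)) hst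
    (kill₁ c s hc _ ?_) (kill₂ c' t hc' _ ?_)).symm.trans (htr ξ))
  · rw [star_diagVec_dotProduct, hs']
    linear_combination -hs
  · rw [star_diagVec_dotProduct, ht']
    linear_combination ht

end
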